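/- Let α ∈ (0,1) ∪ (1,2), let k be an odd integer, and let s ∈ (0,π). Then ∫_0^π sin(η)^α·(−k²·sin(η) + 2ik·cos(η))·e^{ikη}·|sin(s−η)|^{1−α} dη = Σ_{l ∈ ℤ} d_{k,l}·e^{2ils}, where d_{k,l} = (i·sgn(k−2l)/8)·α·(1−α)·((1−α)k² − 4kl)·Γ((α−1)/2 + |l|)·Γ((−1−α)/2 + |k−2l|/2) / ( Γ((3−α)/2 + |l|)·Γ((3+α)/2 + |k−2l|/2) ), and the series over l ∈ ℤ converges absolutely. -/

import Mathlib

open MeasureTheory Filter Set Real intervalIntegral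

/-- The Fourier-type integral of `sin ^ μ` over `[0, π]` at integer frequency `m`. -/
noncomputable def sinFourier (μ : ℝ) (m : ℤ) : ℂ :=
  ∫ η in (0:ℝ)..π, ((Real.sin η ^ μ : ℝ) : ℂ) * Complex.exp (Complex.I * (m : ℂ) * (η : ℂ))

/-- The map `η ↦ (1 - cos η) / 2` carries `(0, π)` onto `(0, 1)`. -/
lemma image_half_one_sub_cos_Ioo :
    (fun η : ℝ => (1 - Real.cos η) / 2) '' Ioo 0 π = Ioo 0 1 := by
  ext x
  constructor
  · rintro ⟨η, hη, rfl⟩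
    have h1 : Real.cos η < 1 := by
      have := Real.cos_lt_cos_of_nonneg_of_le_pi le_rfl hη.2.le hη.1
      simpa using this
    have h2 : -1 < Real.cos η := by
      have := Real.cos_lt_cos_of_nonneg_of_le_pi hη.1.le le_rfl hη.2
      simpa using this
    constructor <;> simp only <;> linarith
  · rintro ⟨h0, h1⟩
    refine ⟨Real.arccos (1 - 2 * x), ⟨?_, ?_⟩, ?_⟩
    · exact Real.arccos_pos.2 (by linarith)
    · refine lt_of_le_of_ne (Real.arccos_le_pi _) fun h => ?_
      rw [Real.arccos_eq_pi] at h
      linarith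
    · simp only
      rw [Real.cos_arccos (by linarith) (by linarith)]
      ring

lemma injOn_half_one_sub_cos_Ioo :
    InjOn (fun η : ℝ => (1 - Real.cos η) / 2) (Ioo 0 π) := by
  intro x hx y hy h
  refine Real.injOn_cos (Ioo_subset_Icc_self hx) (Ioo_subset_Icc_self hy) ?_
  simp only at h
  linarith

lemma hasDerivWithinAt_half_one_sub_cos (s : Set ℝ) (η : ℝ) :
    HasDerivWithinAt (fun η : ℝ => (1 - Real.cos η) / 2) (Real.sin η / 2) s η := by
  have := (((Real.hasDerivAt_cos η).const_sub 1).div_const 2).hasDerivWithinAt (s := s)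
  simpa using this

lemma beta_integrand_half_one_sub_cos (μ : ℝ) {η : ℝ} (hη : η ∈ Ioo 0 π) :
    |Real.sin η / 2| • ((((1 - Real.cos η) / 2 : ℝ) : ℂ) ^ ((((μ + 1) / 2 : ℝ) : ℂ) - 1) *
      (1 - (((1 - Real.cos η) / 2 : ℝ) : ℂ)) ^ ((((μ + 1) / 2 : ℝ) : ℂ) - 1)) =
      (((2 : ℝ) ^ μ)⁻¹ : ℝ) • ((Real.sin η ^ μ : ℝ) : ℂ) := by
  have hs : 0 < Real.sin η := Real.sin_pos_of_mem_Ioo hη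
  have hmem : (1 - Real.cos η) / 2 ∈ Ioo (0 : ℝ) 1 := by
    rw [← image_half_one_sub_cos_Ioo]; exact ⟨η, hη, rfl⟩
  have key : (Real.sin η / 2) * (((1 - Real.cos η) / 2) ^ ((μ + 1) / 2 - 1) *
      (1 - (1 - Real.cos η) / 2) ^ ((μ + 1) / 2 - 1)) = (2 ^ μ)⁻¹ * Real.sin η ^ μ := by
    rw [← Real.mul_rpow hmem.1.le (by linarith [hmem.2])]
    have h2 : (1 - Real.cos η) / 2 * (1 - (1 - Real.cos η) / 2) = (Real.sin η / 2) ^ (2 : ℝ) := by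
      rw [Real.rpow_two]; nlinarith [Real.sin_sq_add_cos_sq η]
    rw [h2, ← Real.rpow_mul (by positivity)]
    have h3 : (Real.sin η / 2) * (Real.sin η / 2) ^ (2 * ((μ + 1) / 2 - 1)) =
        (Real.sin η / 2) ^ μ := by
      rw [show (2 * ((μ + 1) / 2 - 1)) = μ - 1 by ring, Real.rpow_sub_one (by positivity)]
      field_simp
    rw [h3, Real.div_rpow hs.le (by norm_num)]
    ring
  rw [abs_of_pos (by positivity), Complex.real_smul, Complex.real_smul, ← Complex.ofReal_mul, ← key]
  have e1 : (1 : ℂ) - (((1 - Real.cos η) / 2 : ℝ) : ℂ) = ((1 - (1 - Real.cos η) / 2 : ℝ) : ℂ) := by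
    push_cast; ring
  have e2 : (((μ + 1) / 2 : ℝ) : ℂ) - 1 = (((μ + 1) / 2 - 1 : ℝ) : ℂ) := by push_cast; ring
  rw [e1, e2, ← Complex.ofReal_cpow hmem.1.le, ← Complex.ofReal_cpow (by linarith [hmem.2])]
  norm_cast

lemma intervalIntegrable_sin_rpow {μ : ℝ} (hμ : -1 < μ) :
    IntervalIntegrable (fun η : ℝ => ((Real.sin η ^ μ : ℝ) : ℂ)) volume 0 π := by
  have hu : 0 < ((((μ + 1) / 2 : ℝ) : ℂ)).re := by
    rw [Complex.ofReal_re]; linarith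
  have h := Complex.betaIntegral_convergent hu hu
  rw [intervalIntegrable_iff_integrableOn_Ioo_of_le zero_le_one, ← image_half_one_sub_cos_Ioo,
    integrableOn_image_iff_integrableOn_abs_deriv_smul measurableSet_Ioo
      (fun x _ => hasDerivWithinAt_half_one_sub_cos _ x) injOn_half_one_sub_cos_Ioo] at h
  rw [intervalIntegrable_iff_integrableOn_Ioo_of_le pi_pos.le]
  have h2 := (integrableOn_congr_fun (fun η hη => beta_integrand_half_one_sub_cos μ hη)
    measurableSet_Ioo).1 h
  have h3 := h2.smul (2 ^ μ : ℝ)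
  refine (integrableOn_congr_fun (fun η _ => ?_) measurableSet_Ioo).1 h3
  simp only [Pi.smul_apply]
  rw [smul_smul, mul_inv_cancel₀ (by positivity), one_smul]

lemma sinFourier_zero {μ : ℝ} (hμ : -1 < μ) :
    sinFourier μ 0 = ((√π * Real.Gamma ((μ + 1) / 2) / Real.Gamma (μ / 2 + 1) : ℝ) : ℂ) := by
  have hu' : 0 < (μ + 1) / 2 := by linarith
  have hu : 0 < ((((μ + 1) / 2 : ℝ) : ℂ)).re := by rwa [Complex.ofReal_re]
  have h := Complex.betaIntegral_eq_Gamma_mul_div _ _ hu hu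
  rw [Complex.betaIntegral, integral_of_le zero_le_one, integral_Ioc_eq_integral_Ioo,
    ← image_half_one_sub_cos_Ioo,
    integral_image_eq_integral_abs_deriv_smul measurableSet_Ioo
      (fun x _ => hasDerivWithinAt_half_one_sub_cos _ x) injOn_half_one_sub_cos_Ioo,
    setIntegral_congr_fun measurableSet_Ioo
      (fun η hη => beta_integrand_half_one_sub_cos μ hη), MeasureTheory.integral_smul,
    ← integral_Ioc_eq_integral_Ioo, ← integral_of_le pi_pos.le] at h
  have h0 : sinFourier μ 0 = ∫ η in (0:ℝ)..π, ((Real.sin η ^ μ : ℝ) : ℂ) := by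
    simp [sinFourier]
  rw [← h0, ← Complex.ofReal_add, Complex.Gamma_ofReal, Complex.Gamma_ofReal, Complex.real_smul]
    at h
  have hd := Real.Gamma_mul_Gamma_add_half ((μ + 1) / 2)
  rw [show (μ + 1) / 2 + 1 / 2 = μ / 2 + 1 by ring, show 2 * ((μ + 1) / 2) = μ + 1 by ring,
    show 1 - (μ + 1) = -μ by ring, Real.rpow_neg zero_le_two] at hd
  rw [show (μ + 1) / 2 + (μ + 1) / 2 = μ + 1 by ring] at h
  have g1 := Real.Gamma_pos_of_pos hu'
  have g2 : 0 < Real.Gamma (μ / 2 + 1) := Real.Gamma_pos_of_pos (by linarith)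
  have g3 : 0 < Real.Gamma (μ + 1) := Real.Gamma_pos_of_pos (by linarith)
  have hp : (0 : ℝ) < 2 ^ μ := by positivity
  have h4 : sinFourier μ 0 = (2 ^ μ : ℝ) * ((((2 ^ μ)⁻¹ : ℝ) : ℂ) * sinFourier μ 0) := by
    rw [← mul_assoc, ← Complex.ofReal_mul, mul_inv_cancel₀ hp.ne', Complex.ofReal_one, one_mul]
  rw [h4, h]
  norm_cast
  rw [eq_div_iff g2.ne']
  field_simp
  field_simp at hd
  linear_combination hd

lemma intervalIntegrable_sin_rpow_mul {μ : ℝ} (hμ : -1 < μ) {g : ℝ → ℂ} (hg : Continuous g) :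
    IntervalIntegrable (fun η : ℝ => ((Real.sin η ^ μ : ℝ) : ℂ) * g η) volume 0 π :=
  (intervalIntegrable_sin_rpow hμ).mul_continuousOn hg.continuousOn

lemma sin_rpow_add_one {μ : ℝ} (hμ : -1 < μ) {η : ℝ} (hη : 0 ≤ Real.sin η) :
    Real.sin η ^ (μ + 1) = Real.sin η ^ μ * Real.sin η :=
  Real.rpow_add_one' hη (by linarith)

lemma integral_sin_rpow_mul_cos_mul_exp {μ : ℝ} (hμ : -1 < μ) (n : ℤ) :
    ∫ η in (0:ℝ)..π, ((Real.sin η ^ μ : ℝ) : ℂ) *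
        ((Real.cos η : ℂ) * Complex.exp (Complex.I * (n : ℂ) * (η : ℂ))) =
      (sinFourier μ (n + 1) + sinFourier μ (n - 1)) / 2 := by
  rw [sinFourier, sinFourier, ← intervalIntegral.integral_add, ← intervalIntegral.integral_div]
  · refine integral_congr fun η _ => ?_
    rw [Complex.ofReal_cos, Complex.cos]
    have e1 : Complex.exp (Complex.I * ((n + 1 : ℤ) : ℂ) * η) =
        Complex.exp (η * Complex.I) * Complex.exp (Complex.I * n * η) := by
      rw [← Complex.exp_add]; congr 1; push_cast; ring
    have e2 : Complex.exp (Complex.I * ((n - 1 : ℤ) : ℂ) * η) =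
        Complex.exp (-η * Complex.I) * Complex.exp (Complex.I * n * η) := by
      rw [← Complex.exp_add]; congr 1; push_cast; ring
    rw [e1, e2]
    ring
  all_goals exact intervalIntegrable_sin_rpow_mul hμ (by fun_prop)

lemma sinFourier_add_one {μ : ℝ} (hμ : -1 < μ) (n : ℤ) :
    sinFourier (μ + 1) n =
      (sinFourier μ (n - 1) - sinFourier μ (n + 1)) * Complex.I / 2 := by
  rw [sinFourier, sinFourier, sinFourier, ← intervalIntegral.integral_sub,
    ← intervalIntegral.integral_mul_const, ← intervalIntegral.integral_div]
  · refine integral_congr fun η hη => ?_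
    rw [uIcc_of_le pi_pos.le] at hη
    rw [sin_rpow_add_one hμ (Real.sin_nonneg_of_mem_Icc hη), Complex.ofReal_mul,
      Complex.ofReal_sin η, Complex.sin]
    have e1 : Complex.exp (Complex.I * ((n + 1 : ℤ) : ℂ) * η) =
        Complex.exp (η * Complex.I) * Complex.exp (Complex.I * n * η) := by
      rw [← Complex.exp_add]; congr 1; push_cast; ring
    have e2 : Complex.exp (Complex.I * ((n - 1 : ℤ) : ℂ) * η) =
        Complex.exp (-η * Complex.I) * Complex.exp (Complex.I * n * η) := by
      rw [← Complex.exp_add]; congr 1; push_cast; ring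
    rw [e1, e2]
    ring
  all_goals exact intervalIntegrable_sin_rpow_mul hμ (by fun_prop)

lemma integral_sin_rpow_by_parts {μ : ℝ} (hμ : -1 < μ) (n : ℤ) :
    ((μ : ℂ) + 1) * ∫ η in (0:ℝ)..π, ((Real.sin η ^ μ : ℝ) : ℂ) *
        ((Real.cos η : ℂ) * Complex.exp (Complex.I * (n : ℂ) * (η : ℂ))) =
      - (Complex.I * n * sinFourier (μ + 1) n) := by
  have h1 := intervalIntegrable_sin_rpow_mul hμ
    (g := fun η => (Real.cos η : ℂ) * Complex.exp (Complex.I * (n : ℂ) * (η : ℂ))) (by fun_prop)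
  have h2 := intervalIntegrable_sin_rpow_mul (μ := μ + 1) (by linarith)
    (g := fun η => Complex.exp (Complex.I * (n : ℂ) * (η : ℂ))) (by fun_prop)
  rw [eq_neg_iff_add_eq_zero, sinFourier, ← intervalIntegral.integral_const_mul,
    ← intervalIntegral.integral_const_mul,
    ← intervalIntegral.integral_add (h1.const_mul _) (h2.const_mul _)]
  rw [integral_eq_sub_of_hasDerivAt_of_le (f := fun η : ℝ => ((Real.sin η ^ (μ + 1) : ℝ) : ℂ) *
    Complex.exp (Complex.I * (n : ℂ) * (η : ℂ))) pi_pos.le]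
  · simp [Real.zero_rpow (show μ + 1 ≠ 0 by linarith)]
  · refine Continuous.continuousOn ?_
    have : Continuous fun η : ℝ => Real.sin η ^ (μ + 1) :=
      Real.continuous_sin.rpow_const fun _ => Or.inr (by linarith)
    fun_prop
  · intro η hη
    have hs := Real.sin_pos_of_mem_Ioo hη
    have d1 := ((Real.hasDerivAt_sin η).rpow_const (p := μ + 1) (Or.inl hs.ne')).ofReal_comp
    have d2 : HasDerivAt (fun η : ℝ => Complex.exp (Complex.I * (n : ℂ) * (η : ℂ)))
        (Complex.exp (Complex.I * (n : ℂ) * (η : ℂ)) * (Complex.I * n)) η := by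
      have := ((hasDerivAt_id η).ofReal_comp.const_mul (Complex.I * (n : ℂ))).cexp
      simpa using this
    refine (d1.mul d2).congr_deriv ?_
    rw [add_sub_cancel_right]
    push_cast
    ring
  · exact (h1.const_mul _).add (h2.const_mul _)

lemma sinFourier_add_two {μ : ℝ} (hμ : -1 < μ) (m : ℤ) :
    ((m : ℂ) + 2 + μ) * sinFourier μ (m + 2) = (m - μ) * sinFourier μ m := by
  have h := integral_sin_rpow_by_parts hμ (m + 1)
  rw [integral_sin_rpow_mul_cos_mul_exp hμ, sinFourier_add_one hμ,
    show m + 1 + 1 = m + 2 by ring, show m + 1 - 1 = m by ring] at h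
  push_cast at h
  linear_combination 2 * h -
    ((m : ℂ) + 1) * (sinFourier μ m - sinFourier μ (m + 2)) * Complex.I_sq

lemma sinFourier_neg (μ : ℝ) (m : ℤ) :
    sinFourier μ (-m) = (-1) ^ m * sinFourier μ m := by
  have h := integral_comp_sub_left (a := 0) (b := π) (fun η : ℝ =>
    ((Real.sin η ^ μ : ℝ) : ℂ) * Complex.exp (Complex.I * ((-m : ℤ) : ℂ) * (η : ℂ))) π
  rw [sub_self, sub_zero] at h
  rw [sinFourier, ← h, sinFourier, ← intervalIntegral.integral_const_mul]
  refine integral_congr fun η _ => ?_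
  rw [Real.sin_pi_sub]
  have e1 : Complex.exp (Complex.I * ((-m : ℤ) : ℂ) * ((π - η : ℝ) : ℂ)) =
      (-1) ^ m * Complex.exp (Complex.I * m * η) := by
    have h2 : ((-1 : ℂ)) ^ m = Complex.exp ((-m : ℤ) * (π * Complex.I)) := by
      rw [Complex.exp_int_mul, Complex.exp_pi_mul_I, zpow_neg, ← inv_zpow, inv_neg, inv_one]
    rw [h2, ← Complex.exp_add]
    congr 1
    push_cast
    ring
  rw [e1]
  ring

lemma sinFourier_one {μ : ℝ} (hμ : -1 < μ) :
    sinFourier μ 1 = Complex.I * sinFourier (μ + 1) 0 := by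
  have h1 := sinFourier_add_one hμ 0
  have h2 := sinFourier_neg μ 1
  rw [zpow_one] at h2
  rw [zero_sub, zero_add, h2] at h1
  rw [h1]
  linear_combination sinFourier μ 1 * Complex.I_sq

lemma norm_sinFourier_abs (μ : ℝ) (m : ℤ) : ‖sinFourier μ |m|‖ = ‖sinFourier μ m‖ := by
  rcases abs_choice m with h | h
  · rw [h]
  · rw [h, sinFourier_neg, norm_mul, norm_zpow, norm_neg, norm_one, one_zpow, one_mul]

/-- Iterating the two-step recursion expresses `sinFourier μ (2 * n + r)` by Gamma quotients. -/
lemma sinFourier_two_mul_add {μ : ℝ} (hμ : -1 < μ) {r : ℕ}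
    (hr : ∀ n : ℕ, (n : ℝ) + (r - μ) / 2 ≠ 0) (n : ℕ) :
    sinFourier μ (2 * n + r) *
        ((Real.Gamma ((r - μ) / 2) * Real.Gamma (n + (1 + (r + μ) / 2)) : ℝ) : ℂ) =
      sinFourier μ r *
        ((Real.Gamma (n + (r - μ) / 2) * Real.Gamma (1 + (r + μ) / 2) : ℝ) : ℂ) := by
  induction n with
  | zero => simp
  | succ n ih =>
    have hpos : (0 : ℝ) < n + (1 + (r + μ) / 2) := by
      have : (0 : ℝ) ≤ n := n.cast_nonneg
      have : (0 : ℝ) ≤ r := r.cast_nonneg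
      linarith
    have hrec := sinFourier_add_two hμ (2 * n + r)
    have g1 := Real.Gamma_add_one (hr n)
    have g2 := Real.Gamma_add_one hpos.ne'
    rw [show ((n + 1 : ℕ) : ℝ) + (1 + (r + μ) / 2) = n + (1 + (r + μ) / 2) + 1 by push_cast; ring,
      show ((n + 1 : ℕ) : ℝ) + (r - μ) / 2 = n + (r - μ) / 2 + 1 by push_cast; ring, g1, g2,
      show (2 * ((n + 1 : ℕ) : ℤ) + r) = 2 * n + r + 2 by push_cast; ring]
    push_cast at hrec ih ⊢
    linear_combination (1 / 2 * (Real.Gamma ((r - μ) / 2) : ℂ) *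
      Real.Gamma (n + (1 + (r + μ) / 2))) * hrec + ((2 * n + r - μ) / 2 : ℂ) * ih

lemma summable_odd_mul_norm_sinFourier {μ : ℝ} (h1 : 1 < μ) (h3 : μ < 3) :
    Summable fun n : ℕ => (2 * n + 1 : ℝ) * ‖sinFourier μ (2 * n + 1)‖ := by
  rw [← summable_nat_add_iff 1]
  set a : ℕ → ℝ := fun n => ‖sinFourier μ (2 * n + 3)‖ with ha
  set T : ℕ → ℝ := fun n => (2 * n + 3 + μ) * (2 * n + 3) * a n with hT
  have hstep (n : ℕ) : (2 * n + 3 + 2 + μ) * a (n + 1) = (2 * n + 3 - μ) * a n := by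
    have h := congrArg norm (sinFourier_add_two (μ := μ) (by linarith) (2 * n + 3))
    rw [norm_mul, norm_mul] at h
    have hn : (0 : ℝ) ≤ n := n.cast_nonneg
    have e1 : ‖(((2 * n + 3 : ℤ) : ℂ) + 2 + μ)‖ = 2 * n + 3 + 2 + μ := by
      rw [show (((2 * n + 3 : ℤ) : ℂ) + 2 + μ) = ((2 * n + 3 + 2 + μ : ℝ) : ℂ) by push_cast; ring,
        Complex.norm_real, Real.norm_of_nonneg (by linarith)]
    have e2 : ‖(((2 * n + 3 : ℤ) : ℂ) - μ)‖ = 2 * n + 3 - μ := by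
      rw [show (((2 * n + 3 : ℤ) : ℂ) - μ) = ((2 * n + 3 - μ : ℝ) : ℂ) by push_cast; ring,
        Complex.norm_real, Real.norm_of_nonneg (by linarith)]
    rw [e1, e2] at h
    rw [← h, ha]
    simp only
    rw [show (2 * ((n + 1 : ℕ) : ℤ) + 3) = 2 * n + 3 + 2 by push_cast; ring]
  have hsum (N : ℕ) : (2 * μ - 2) * ∑ n ∈ Finset.range N, (2 * n + 3 : ℝ) * a n ≤ T 0 - T N := by
    induction N with
    | zero => simp
    | succ N ih =>
      rw [Finset.sum_range_succ, mul_add]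
      have h := hstep N
      have hN : (0 : ℝ) ≤ a N := norm_nonneg _
      have : T (N + 1) = (2 * N + 3 + 2) * ((2 * N + 3 - μ) * a N) := by
        rw [← h, hT]; push_cast; ring
      rw [this]
      have : T N = (2 * N + 3 + μ) * (2 * N + 3) * a N := rfl
      nlinarith
  refine summable_of_sum_range_le (c := T 0 / (2 * μ - 2)) (fun n => by positivity) fun N => ?_
  rw [le_div_iff₀ (by linarith), mul_comm]
  have hTN : 0 ≤ T N := by
    have : (0 : ℝ) ≤ N := N.cast_nonneg
    have : 0 ≤ a N := norm_nonneg _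
    simp only [hT]
    positivity
  refine le_trans (le_of_eq ?_) ((hsum N).trans (by linarith))
  congr 1
  refine Finset.sum_congr rfl fun n _ => ?_
  have e : (2 * ((n + 1 : ℕ) : ℤ) + 1) = 2 * n + 3 := by push_cast; ring
  rw [e]
  push_cast
  ring

lemma summable_abs_mul_norm_sinFourier_odd {μ : ℝ} (h1 : 1 < μ) (h3 : μ < 3) {k : ℤ}
    (hk : Odd k) :
    Summable fun l : ℤ => |(k : ℝ) - 2 * l| * ‖sinFourier μ (k - 2 * l)‖ := by
  obtain ⟨j, rfl⟩ := hk
  have h := summable_odd_mul_norm_sinFourier h1 h3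
  have hZ : Summable fun n : ℤ => |(2 * n + 1 : ℝ)| * ‖sinFourier μ (2 * n + 1)‖ := by
    refine Summable.of_nat_of_neg_add_one ?_ ?_
    · refine h.congr fun n => ?_
      push_cast
      rw [abs_of_nonneg (by positivity)]
    · refine h.congr fun n => ?_
      rw [← norm_sinFourier_abs μ (2 * -((n : ℤ) + 1) + 1),
        show |2 * -((n : ℤ) + 1) + 1| = 2 * n + 1 by
          rw [show 2 * -((n : ℤ) + 1) + 1 = -(2 * n + 1) by ring, abs_neg,
            abs_of_nonneg (by positivity)]]
      congr 1
      push_cast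
      rw [show 2 * -((n : ℝ) + 1) + 1 = -(2 * n + 1) by ring, abs_neg,
        abs_of_nonneg (by positivity)]
  refine ((Equiv.subLeft j).summable_iff.2 hZ).congr fun l => ?_
  simp only [Function.comp_apply, Equiv.subLeft_apply]
  rw [show 2 * (j - l) + 1 = 2 * j + 1 - 2 * l by ring]
  congr 2
  push_cast
  ring

lemma sinFourier_even {μ : ℝ} (hμ : -1 < μ) (hr : ∀ n : ℕ, (n : ℝ) + -μ / 2 ≠ 0) (l : ℤ) :
    sinFourier μ (2 * l) = sinFourier μ 0 *
      ((Real.Gamma (-μ / 2 + |(l : ℝ)|) * Real.Gamma (1 + μ / 2) /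
        (Real.Gamma (-μ / 2) * Real.Gamma (1 + μ / 2 + |(l : ℝ)|)) : ℝ) : ℂ) := by
  wlog hl : 0 ≤ l generalizing l
  · have h := this (-l) (by omega)
    rw [mul_neg, sinFourier_neg, Even.neg_one_zpow ⟨l, by ring⟩, one_mul] at h
    rw [h]
    push_cast
    rw [abs_neg]
  lift l to ℕ using hl
  have h := sinFourier_two_mul_add hμ (r := 0) (by simpa using hr) l
  simp only [Nat.cast_zero, add_zero, zero_sub, zero_add] at h
  have hl0 : (0 : ℝ) ≤ l := l.cast_nonneg
  have g1 : Real.Gamma (-μ / 2) ≠ 0 := Real.Gamma_ne_zero fun m hm => hr m (by rw [hm]; ring)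
  have g2 : Real.Gamma (1 + μ / 2 + l) ≠ 0 := (Real.Gamma_pos_of_pos (by linarith)).ne'
  rw [Int.cast_natCast, abs_of_nonneg hl0, Complex.ofReal_div, ← mul_div_assoc,
    eq_div_iff (by exact_mod_cast mul_ne_zero g1 g2), add_comm (-μ / 2), add_comm (1 + μ / 2)]
  exact h

lemma sinFourier_odd {μ : ℝ} (hμ : -1 < μ) (hr : ∀ n : ℕ, (n : ℝ) + (1 - μ) / 2 ≠ 0) {m : ℤ}
    (hm : Odd m) :
    sinFourier μ m = Complex.I * (Int.sign m : ℂ) * sinFourier (μ + 1) 0 *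
      ((Real.Gamma (-μ / 2 + |(m : ℝ)| / 2) * Real.Gamma ((3 + μ) / 2) /
        (Real.Gamma ((1 - μ) / 2) * Real.Gamma (1 + μ / 2 + |(m : ℝ)| / 2)) : ℝ) : ℂ) := by
  wlog hl : 0 ≤ m generalizing m
  · have h := this hm.neg (by omega)
    rw [sinFourier_neg, hm.neg_one_zpow, Int.sign_neg] at h
    push_cast at h ⊢
    rw [abs_neg] at h
    linear_combination -h
  obtain ⟨j, rfl⟩ := hm
  lift j to ℕ using by omega
  have h := sinFourier_two_mul_add hμ (r := 1) (by simpa using hr) j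
  simp only [Nat.cast_one] at h
  have hj0 : (0 : ℝ) ≤ j := j.cast_nonneg
  have g1 : Real.Gamma ((1 - μ) / 2) ≠ 0 :=
    Real.Gamma_ne_zero fun m hm => hr m (by rw [hm]; ring)
  have g2 : Real.Gamma (j + (1 + (1 + μ) / 2)) ≠ 0 := (Real.Gamma_pos_of_pos (by linarith)).ne'
  have hs : Int.sign (2 * (j : ℤ) + 1) = 1 := Int.sign_eq_one_of_pos (by omega)
  have habs : |((2 * (j : ℤ) + 1 : ℤ) : ℝ)| = 2 * j + 1 := by
    push_cast; exact abs_of_nonneg (by positivity)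
  rw [hs, habs, Complex.ofReal_div, ← mul_div_assoc,
    show 1 + μ / 2 + (2 * (j : ℝ) + 1) / 2 = j + (1 + (1 + μ) / 2) by ring,
    show -μ / 2 + (2 * (j : ℝ) + 1) / 2 = j + (1 - μ) / 2 by ring,
    eq_div_iff (by exact_mod_cast mul_ne_zero g1 g2), h, sinFourier_one hμ,
    show 1 + (1 + μ) / 2 = (3 + μ) / 2 by ring]
  simp

/-- Fourier expansion of the convolution over a period of a continuous `π`-periodic function with
absolutely convergent Fourier series with an integrable `π`-periodic function. -/
lemma hasSum_integral_mul_comp_sub {f g : ℝ → ℂ} (hf : Continuous f) (hfp : Function.Periodic f π)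
    (hg : IntervalIntegrable g volume 0 π) (hgp : Function.Periodic g π) {c : ℤ → ℂ}
    (hc : ∀ l : ℤ, c l =
      1 / π * ∫ η in (0:ℝ)..π, Complex.exp (-2 * Complex.I * l * η) * f η)
    (hcs : Summable c) (s : ℝ) :
    HasSum (fun l : ℤ => c l * (∫ η in (0:ℝ)..π, g η * Complex.exp (-2 * Complex.I * l * η)) *
      Complex.exp (2 * Complex.I * l * s)) (∫ η in (0:ℝ)..π, f η * g (s - η)) := by
  have : Fact (0 < π) := ⟨pi_pos⟩
  have hpi : (π : ℂ) ≠ 0 := Complex.ofReal_ne_zero.2 pi_ne_zero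
  let F : C(AddCircle π, ℂ) := ⟨hfp.lift, continuous_quot_lift _ hf⟩
  have hF (x : ℝ) : F (x : AddCircle π) = f x := rfl
  have hfour (l : ℤ) (x : ℝ) :
      fourier l (x : AddCircle π) = Complex.exp (2 * Complex.I * l * x) := by
    rw [fourier_coe_apply]
    congr 1
    field_simp
  have hcoeff : fourierCoeff F = c := by
    ext l
    rw [fourierCoeff_eq_intervalIntegral F l 0, hc, zero_add, Complex.real_smul]
    push_cast
    congr 1
    refine integral_congr fun η _ => ?_
    rw [hfour, smul_eq_mul, hF]
    push_cast
    congr 2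
    ring
  have hser (x : ℝ) : HasSum (fun l : ℤ => c l * Complex.exp (2 * Complex.I * l * x)) (f x) := by
    have h := has_pointwise_sum_fourier_series_of_summable (f := F) (by rwa [hcoeff]) x
    simpa only [hcoeff, hfour, smul_eq_mul, hF] using h
  have hg' : IntervalIntegrable (fun η => g (s - η)) volume 0 π := by
    have h := (hgp.intervalIntegrable₀ pi_ne_zero hg (s - 0) (s - π)).comp_sub_left s
    simpa using h
  have hnorm (l : ℤ) (x : ℝ) : ‖Complex.exp (2 * Complex.I * l * x)‖ = 1 := by
    rw [show 2 * Complex.I * l * x = ((2 * l * x : ℝ) : ℂ) * Complex.I by push_cast; ring,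
      Complex.norm_exp_ofReal_mul_I]
  have hint (l : ℤ) : ∫ η in (0:ℝ)..π, c l * Complex.exp (2 * Complex.I * l * η) * g (s - η) =
      c l * (∫ η in (0:ℝ)..π, g η * Complex.exp (-2 * Complex.I * l * η)) *
        Complex.exp (2 * Complex.I * l * s) := by
    have h1 := integral_comp_sub_left (a := 0) (b := π)
      (fun η : ℝ => g η * Complex.exp (-2 * Complex.I * l * η)) s
    have hper : Function.Periodic
        (fun η : ℝ => g η * Complex.exp (-2 * Complex.I * l * η)) π := by
      intro η
      simp only
      rw [hgp η]
      congr 1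
      rw [show -2 * Complex.I * l * ((η + π : ℝ) : ℂ) =
        -2 * Complex.I * l * η + ((-l : ℤ) : ℂ) * (2 * π * Complex.I) by push_cast; ring,
        Complex.exp_add, Complex.exp_int_mul_two_pi_mul_I, mul_one]
    have h2 := hper.intervalIntegral_add_eq (s - π) 0
    rw [sub_add_cancel, zero_add] at h2
    rw [sub_zero, h2] at h1
    rw [← h1, ← intervalIntegral.integral_const_mul, ← intervalIntegral.integral_mul_const]
    refine integral_congr fun η _ => ?_
    have : Complex.exp (2 * Complex.I * l * η) =
        Complex.exp (-2 * Complex.I * l * ((s - η : ℝ) : ℂ)) *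
          Complex.exp (2 * Complex.I * l * s) := by
      rw [← Complex.exp_add]; congr 1; push_cast; ring
    rw [this]
    ring
  simp_rw [← hint]
  refine intervalIntegral.hasSum_integral_of_dominated_convergence
    (fun l η => ‖c l‖ * ‖g (s - η)‖) (fun l => ?_) (fun l => ?_) ?_ ?_ ?_
  · refine AEStronglyMeasurable.mul ?_
      (by rw [uIoc_of_le pi_pos.le]; exact hg'.1.aestronglyMeasurable)
    exact Continuous.aestronglyMeasurable (by fun_prop)
  · refine Eventually.of_forall fun η _ => ?_
    rw [norm_mul, norm_mul, hnorm, mul_one]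
  · exact Eventually.of_forall fun η _ => hcs.norm.mul_right _
  · simp_rw [tsum_mul_right]
    exact hg'.norm.const_mul _
  · exact Eventually.of_forall fun η _ => (hser η).mul_right _

lemma fourier_sin_rpow_kernel {α : ℝ} (hα : -1 < α) (k l : ℤ) :
    ∫ η in (0:ℝ)..π, Complex.exp (-2 * Complex.I * l * η) *
      (((|Real.sin η| ^ α : ℝ) : ℂ)
        * (-(k : ℂ) ^ 2 * (Real.sin η : ℂ) + 2 * Complex.I * (k : ℂ) * (Real.cos η : ℂ))
        * Complex.exp (Complex.I * (k : ℂ) * (η : ℂ))) =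
      k * ((1 - α) * k - 4 * l) / (α + 1) * sinFourier (α + 1) (k - 2 * l) := by
  have hα' : (α : ℂ) + 1 ≠ 0 := by
    exact_mod_cast (show α + 1 ≠ 0 by linarith)
  have hp := integral_sin_rpow_by_parts hα (k - 2 * l)
  have h1 := intervalIntegrable_sin_rpow_mul hα (g := fun η => (Real.cos η : ℂ) *
    Complex.exp (Complex.I * ((k - 2 * l : ℤ) : ℂ) * (η : ℂ))) (by fun_prop)
  have h2 := intervalIntegrable_sin_rpow_mul (μ := α + 1) (by linarith)
    (g := fun η => Complex.exp (Complex.I * ((k - 2 * l : ℤ) : ℂ) * (η : ℂ))) (by fun_prop)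
  have hsplit : ∫ η in (0:ℝ)..π, Complex.exp (-2 * Complex.I * l * η) *
      (((|Real.sin η| ^ α : ℝ) : ℂ)
        * (-(k : ℂ) ^ 2 * (Real.sin η : ℂ) + 2 * Complex.I * (k : ℂ) * (Real.cos η : ℂ))
        * Complex.exp (Complex.I * (k : ℂ) * (η : ℂ))) =
      -(k : ℂ) ^ 2 * sinFourier (α + 1) (k - 2 * l) + 2 * Complex.I * k *
        ∫ η in (0:ℝ)..π, ((Real.sin η ^ α : ℝ) : ℂ) * ((Real.cos η : ℂ) *
          Complex.exp (Complex.I * ((k - 2 * l : ℤ) : ℂ) * (η : ℂ))) := by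
    rw [sinFourier, ← intervalIntegral.integral_const_mul, ← intervalIntegral.integral_const_mul,
      ← intervalIntegral.integral_add (h2.const_mul _) (h1.const_mul _)]
    refine integral_congr fun η hη => ?_
    rw [uIcc_of_le pi_pos.le] at hη
    have hs := Real.sin_nonneg_of_mem_Icc hη
    have e : Complex.exp (Complex.I * ((k - 2 * l : ℤ) : ℂ) * (η : ℂ)) =
        Complex.exp (-2 * Complex.I * l * η) * Complex.exp (Complex.I * (k : ℂ) * (η : ℂ)) := by
      rw [← Complex.exp_add]; congr 1; push_cast; ring
    rw [e, abs_of_nonneg hs, sin_rpow_add_one hα hs]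
    push_cast
    ring
  rw [hsplit, div_mul_eq_mul_div, eq_div_iff hα']
  push_cast at hp ⊢
  linear_combination 2 * Complex.I * k * hp -
    2 * k * (k - 2 * l) * sinFourier (α + 1) (k - 2 * l) * Complex.I_sq

lemma periodic_abs_sin_rpow (p : ℝ) :
    Function.Periodic (fun x : ℝ => ((|Real.sin x| ^ p : ℝ) : ℂ)) π := by
  intro x
  simp only
  rw [Real.sin_add_pi, abs_neg]

lemma periodic_sin_rpow_kernel (α : ℝ) {k : ℤ} (hk : Odd k) :
    Function.Periodic (fun η : ℝ => ((|Real.sin η| ^ α : ℝ) : ℂ)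
      * (-(k : ℂ) ^ 2 * (Real.sin η : ℂ) + 2 * Complex.I * (k : ℂ) * (Real.cos η : ℂ))
      * Complex.exp (Complex.I * (k : ℂ) * (η : ℂ))) π := by
  intro η
  have e : Complex.exp (Complex.I * (k : ℂ) * ((η + π : ℝ) : ℂ)) =
      -Complex.exp (Complex.I * (k : ℂ) * (η : ℂ)) := by
    rw [show Complex.I * (k : ℂ) * ((η + π : ℝ) : ℂ) =
      Complex.I * (k : ℂ) * η + k * (π * Complex.I) by push_cast; ring, Complex.exp_add,
      Complex.exp_int_mul, Complex.exp_pi_mul_I, hk.neg_one_zpow, mul_neg_one]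
  simp only
  rw [e, Real.sin_add_pi, Real.cos_add_pi, abs_neg]
  push_cast
  ring

lemma continuous_sin_rpow_kernel {α : ℝ} (hα : 0 ≤ α) (k : ℤ) :
    Continuous fun η : ℝ => ((|Real.sin η| ^ α : ℝ) : ℂ)
      * (-(k : ℂ) ^ 2 * (Real.sin η : ℂ) + 2 * Complex.I * (k : ℂ) * (Real.cos η : ℂ))
      * Complex.exp (Complex.I * (k : ℂ) * (η : ℂ)) := by
  have : Continuous fun η : ℝ => |Real.sin η| ^ α :=
    Real.continuous_sin.abs.rpow_const fun _ => Or.inr hα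
  fun_prop

lemma integral_abs_sin_rpow_mul_exp (p : ℝ) (l : ℤ) :
    ∫ η in (0:ℝ)..π, ((|Real.sin η| ^ p : ℝ) : ℂ) * Complex.exp (-2 * Complex.I * l * η) =
      sinFourier p (2 * l) := by
  have h : sinFourier p (2 * l) = sinFourier p (-(2 * l)) := by
    rw [sinFourier_neg, Even.neg_one_zpow ⟨l, by ring⟩, one_mul]
  rw [h, sinFourier]
  refine integral_congr fun η hη => ?_
  rw [uIcc_of_le pi_pos.le] at hη
  rw [abs_of_nonneg (Real.sin_nonneg_of_mem_Icc hη)]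
  push_cast
  congr 2
  ring

lemma summable_fourier_sin_rpow_kernel {α : ℝ} (hα0 : 0 < α) (hα2 : α < 2) {k : ℤ}
    (hk : Odd k) :
    Summable fun l : ℤ => 1 / (π : ℂ) *
      (k * ((1 - α) * k - 4 * l) / (α + 1) * sinFourier (α + 1) (k - 2 * l)) := by
  have h := summable_abs_mul_norm_sinFourier_odd (μ := α + 1) (by linarith) (by linarith) hk
  refine Summable.mul_left _ ?_
  refine Summable.of_norm_bounded (h.mul_left (|(k : ℝ)| * (2 + (1 + α) * |(k : ℝ)|) / (α + 1)))
    fun l => ?_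
  have hc : ((k : ℂ) * ((1 - α) * k - 4 * l) / (α + 1)) =
      ((k * (2 * (k - 2 * l) - (1 + α) * k) / (α + 1) : ℝ) : ℂ) := by push_cast; ring
  rw [hc, norm_mul, Complex.norm_real, Real.norm_eq_abs, ← mul_assoc]
  refine mul_le_mul_of_nonneg_right ?_ (norm_nonneg _)
  have h1 : (1 : ℝ) ≤ |(k : ℝ) - 2 * l| := by
    have : 1 ≤ |k - 2 * l| := Int.one_le_abs (by obtain ⟨j, rfl⟩ := hk; omega)
    exact_mod_cast this
  rw [abs_div, abs_mul, abs_of_pos (show 0 < α + 1 by linarith), div_mul_eq_mul_div, mul_assoc]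
  gcongr
  calc |2 * ((k : ℝ) - 2 * l) - (1 + α) * k| ≤ |2 * ((k : ℝ) - 2 * l)| + |(1 + α) * k| := abs_sub _ _
    _ = 2 * |(k : ℝ) - 2 * l| + (1 + α) * |(k : ℝ)| * 1 := by
      rw [abs_mul, abs_mul, abs_two, abs_of_pos (show 0 < 1 + α by linarith), mul_one]
    _ ≤ 2 * |(k : ℝ) - 2 * l| + (1 + α) * |(k : ℝ)| * |(k : ℝ) - 2 * l| := by gcongr
    _ = _ := by ring

lemma mul_sinFourier_eq {α : ℝ} (hα : α ∈ Set.Ioo (0:ℝ) 1 ∪ Set.Ioo (1:ℝ) 2)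
    {k : ℤ} (hk : Odd k) (l : ℤ) :
    1 / (π : ℂ) * (k * ((1 - α) * k - 4 * l) / (α + 1) * sinFourier (α + 1) (k - 2 * l)) *
        sinFourier (1 - α) (2 * l) =
      Complex.I * (Int.sign (k - 2 * l) : ℂ) / 8
          * ((α * (1 - α) * ((1 - α) * (k : ℝ) ^ 2 - 4 * (k : ℝ) * (l : ℝ))
              * (Real.Gamma ((α - 1) / 2 + |(l : ℝ)|)
                  * Real.Gamma ((-1 - α) / 2 + |(k : ℝ) - 2 * (l : ℝ)| / 2)
                / (Real.Gamma ((3 - α) / 2 + |(l : ℝ)|)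
                  * Real.Gamma ((3 + α) / 2 + |(k : ℝ) - 2 * (l : ℝ)| / 2))) : ℝ) : ℂ) := by
  have hα0 : 0 < α := by rcases hα with h | h <;> linarith [h.1]
  have hα2 : α < 2 := by rcases hα with h | h <;> linarith [h.2]
  have hα1 : α ≠ 1 := by rcases hα with h | h <;> [exact h.2.ne; exact h.1.ne']
  have hne1 (n : ℕ) : (n : ℝ) + (1 - (α + 1)) / 2 ≠ 0 := by
    rcases Nat.eq_zero_or_pos n with rfl | hn
    · simp only [Nat.cast_zero]; linarith
    · have : (1 : ℝ) ≤ n := by exact_mod_cast hn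
      linarith
  have hne2 (n : ℕ) : (n : ℝ) + -(1 - α) / 2 ≠ 0 := by
    rcases Nat.eq_zero_or_pos n with rfl | hn
    · intro h; apply hα1; simp only [Nat.cast_zero] at h; linarith
    · have : (1 : ℝ) ≤ n := by exact_mod_cast hn
      linarith
  have hodd : Odd (k - 2 * l) := hk.sub_even ⟨l, by ring⟩
  rw [sinFourier_even (by linarith) hne2, sinFourier_odd (by linarith) hne1 hodd,
    sinFourier_zero (by linarith), sinFourier_zero (by linarith)]
  rw [show ((k - 2 * l : ℤ) : ℝ) = (k : ℝ) - 2 * l by push_cast; ring]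
  rw [show (α + 1 + 1 + 1) / 2 = (α + 1) / 2 + 1 by ring,
    show (α + 1 + 1) / 2 + 1 = 2 + α / 2 by ring,
    show -(α + 1) / 2 = (-1 - α) / 2 by ring,
    show (3 + (α + 1)) / 2 = 2 + α / 2 by ring,
    show (1 - (α + 1)) / 2 = -α / 2 by ring,
    show 1 + (α + 1) / 2 = (3 + α) / 2 by ring,
    show (1 - α + 1) / 2 = -α / 2 + 1 by ring,
    show (1 - α) / 2 + 1 = (3 - α) / 2 by ring,
    show 1 + (1 - α) / 2 = (3 - α) / 2 by ring,
    show -(1 - α) / 2 = (α - 1) / 2 by ring,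
    show (α + 1) / 2 + 1 = (α - 1) / 2 + 1 + 1 by ring,
    Real.Gamma_add_one (show -α / 2 ≠ 0 by linarith),
    Real.Gamma_add_one (show (α - 1) / 2 + 1 ≠ 0 by linarith),
    Real.Gamma_add_one (show (α - 1) / 2 ≠ 0 by intro h; apply hα1; linarith)]
  have g1 : Real.Gamma (-α / 2) ≠ 0 :=
    Real.Gamma_ne_zero fun m hm => hne1 m (by linarith)
  have g2 : Real.Gamma ((α - 1) / 2) ≠ 0 :=
    Real.Gamma_ne_zero fun m hm => hne2 m (by linarith)
  have g3 : Real.Gamma (2 + α / 2) ≠ 0 := (Real.Gamma_pos_of_pos (by linarith)).ne'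
  have g4 : Real.Gamma ((3 - α) / 2) ≠ 0 := (Real.Gamma_pos_of_pos (by linarith)).ne'
  have g5 : Real.Gamma ((3 - α) / 2 + |(l : ℝ)|) ≠ 0 :=
    (Real.Gamma_pos_of_pos (by linarith [abs_nonneg (l : ℝ)])).ne'
  have g6 : Real.Gamma ((3 + α) / 2 + |(k : ℝ) - 2 * l| / 2) ≠ 0 :=
    (Real.Gamma_pos_of_pos (by linarith [abs_nonneg ((k : ℝ) - 2 * l)])).ne'
  have hα1' : α + 1 ≠ 0 := by linarith
  generalize Real.Gamma (-α / 2) = A at *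
  generalize Real.Gamma ((α - 1) / 2) = B at *
  generalize Real.Gamma (2 + α / 2) = C at *
  generalize Real.Gamma ((3 - α) / 2) = D at *
  generalize Real.Gamma ((3 - α) / 2 + |(l : ℝ)|) = E at *
  generalize Real.Gamma ((3 + α) / 2 + |(k : ℝ) - 2 * l| / 2) = G at *
  generalize Real.Gamma ((α - 1) / 2 + |(l : ℝ)|) = P at *
  generalize Real.Gamma ((-1 - α) / 2 + |(k : ℝ) - 2 * (l : ℝ)| / 2) = Q at *
  have key : 1 / π * (k * ((1 - α) * k - 4 * l) / (α + 1) *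
      ((√π * (((α - 1) / 2 + 1) * ((α - 1) / 2 * B)) / C) * (Q * C / (A * G)))) *
      ((√π * (-α / 2 * A) / D) * (P * D / (B * E))) =
      1 / 8 * (α * (1 - α) * ((1 - α) * (k : ℝ) ^ 2 - 4 * (k : ℝ) * (l : ℝ)) * (P * Q / (E * G))) := by
    have hpi : √π * √π = π := Real.mul_self_sqrt pi_pos.le
    have hsq : √π ≠ 0 := (Real.sqrt_pos.2 pi_pos).ne'
    generalize √π = w at hpi hsq ⊢
    rw [← hpi]
    field_simp
    ring
  have key' := congrArg (fun x : ℝ => (x : ℂ)) key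
  push_cast at key' ⊢
  linear_combination (Complex.I * (Int.sign (k - 2 * l) : ℂ)) * key'

/-- Odd-k case of formula (16) in Theorem 1 of the paper: Fourier series expansion. -/
theorem stmt_17 (α : ℝ) (hα : α ∈ Set.Ioo (0:ℝ) 1 ∪ Set.Ioo (1:ℝ) 2)
    (k : ℤ) (hk : Odd k) (s : ℝ) (hs : s ∈ Set.Ioo 0 π) :
    Summable (fun l : ℤ =>
      ‖Complex.I * (Int.sign (k - 2 * l) : ℂ) / 8
          * ((α * (1 - α) * ((1 - α) * (k : ℝ) ^ 2 - 4 * (k : ℝ) * (l : ℝ))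
              * (Real.Gamma ((α - 1) / 2 + |(l : ℝ)|)
                  * Real.Gamma ((-1 - α) / 2 + |(k : ℝ) - 2 * (l : ℝ)| / 2)
                / (Real.Gamma ((3 - α) / 2 + |(l : ℝ)|)
                  * Real.Gamma ((3 + α) / 2 + |(k : ℝ) - 2 * (l : ℝ)| / 2))) : ℝ) : ℂ)
        * Complex.exp (2 * Complex.I * (l : ℂ) * (s : ℂ))‖) ∧
    ∫ η in (0:ℝ)..π,
        ((Real.sin η ^ α : ℝ) : ℂ)
          * (-(k : ℂ) ^ 2 * (Real.sin η : ℂ) + 2 * Complex.I * (k : ℂ) * (Real.cos η : ℂ))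
          * Complex.exp (Complex.I * (k : ℂ) * (η : ℂ))
          * ((|Real.sin (s - η)| ^ (1 - α) : ℝ) : ℂ)
      = ∑' l : ℤ,
          Complex.I * (Int.sign (k - 2 * l) : ℂ) / 8
            * ((α * (1 - α) * ((1 - α) * (k : ℝ) ^ 2 - 4 * (k : ℝ) * (l : ℝ))
                * (Real.Gamma ((α - 1) / 2 + |(l : ℝ)|)
                    * Real.Gamma ((-1 - α) / 2 + |(k : ℝ) - 2 * (l : ℝ)| / 2)
                  / (Real.Gamma ((3 - α) / 2 + |(l : ℝ)|)
                    * Real.Gamma ((3 + α) / 2 + |(k : ℝ) - 2 * (l : ℝ)| / 2))) : ℝ) : ℂ)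
            * Complex.exp (2 * Complex.I * (l : ℂ) * (s : ℂ)) := by
  have hα0 : 0 < α := by rcases hα with h | h <;> linarith [h.1]
  have hα2 : α < 2 := by rcases hα with h | h <;> linarith [h.2]
  have hg : IntervalIntegrable (fun η : ℝ => ((|Real.sin η| ^ (1 - α) : ℝ) : ℂ)) volume 0 π := by
    refine (intervalIntegrable_sin_rpow (μ := 1 - α) (by linarith)).congr fun η hη => ?_
    rw [uIoc_of_le pi_pos.le] at hη
    rw [abs_of_nonneg (Real.sin_nonneg_of_mem_Icc (Ioc_subset_Icc_self hη))]
  have h := hasSum_integral_mul_comp_sub (continuous_sin_rpow_kernel hα0.le k)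
    (periodic_sin_rpow_kernel α hk) hg (periodic_abs_sin_rpow (1 - α))
    (fun l => by rw [fourier_sin_rpow_kernel (by linarith)])
    (summable_fourier_sin_rpow_kernel hα0 hα2 hk) s
  simp only [integral_abs_sin_rpow_mul_exp, mul_sinFourier_eq hα hk] at h
  refine ⟨h.summable.norm, ?_⟩
  rw [h.tsum_eq]
  refine integral_congr fun η hη => ?_
  rw [uIcc_of_le pi_pos.le] at hη
  rw [abs_of_nonneg (Real.sin_nonneg_of_mem_Icc hη)]
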